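/- Let m, n be nonnegative integers with n ≥ 1 and let δ ≤ 0 be a real number. Let A_{m,n} be the n×n real matrix whose (r,c)-entry (for r, c ∈ {1, …, n}) is (m+r)_c · ∏_{j=m+r−1}^{m+r+c−2}(1−jδ). Then the linear system A_{m,n} λ = (1, 1, …, 1)ᵗ has the unique solution λ = (λ₁, …, λ_n)ᵗ with λ_i = (−1)^{i−1} C(n,i) / [(m+n)_i ∏_{j=m}^{m+i−1}(1−jδ)] for i = 1, …, n. -/

import Mathlib

open MeasureTheory ProbabilityTheory Finset Filter

noncomputable section

/-- Falling factorial `(x)_k = x (x-1) ⋯ (x-k+1)`, with `(x)_0 = 1`. -/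
def fall (x : ℝ) (k : ℕ) : ℝ := ∏ j ∈ Finset.range k, (x - j)

/-- Rising factorial `[x]_k = x (x+1) ⋯ (x+k-1)`, with `[x]_0 = 1`. -/
def rise (x : ℝ) (k : ℕ) : ℝ := ∏ j ∈ Finset.range k, (x + j)

/-- The product `∏_{j=a}^{a+len-1} (1 - j δ)` of `len` consecutive factors
(an empty product is `1`). -/
def pp (δ a : ℝ) (len : ℕ) : ℝ := ∏ j ∈ Finset.range len, (1 - (a + j) * δ)

/-- The open real interval with (possibly infinite) endpoints `α ω : EReal`. -/
def erealIoo (α ω : EReal) : Set ℝ := {x : ℝ | α < (x : EReal) ∧ (x : EReal) < ω}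

/-- `g` coincides on `J` with a polynomial of degree at most `d`. -/
def IsPolyOn (g : ℝ → ℝ) (J : Set ℝ) (d : ℕ) : Prop :=
  ∃ p : Polynomial ℝ, p.natDegree ≤ d ∧ ∀ x ∈ J, g x = p.eval x

/-- The quadratic `q(x) = δ x² + β x + γ` of a Pearson family. -/
def pq (δ β γ : ℝ) : ℝ → ℝ := fun x => δ * x ^ 2 + β * x + γ

/-- `P` is the distribution of a random variable with density `f` (w.r.t. Lebesgue
measure) belonging to the integrated Pearson family `IP(μ; δ, β, γ)`:
`μ` is the (finite) mean of `P`, `|δ|+|β|+|γ| > 0`, and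
`∫_{-∞}^x (μ - t) f(t) dt = q(x) f(x)` for all `x`. -/
def IsIntegratedPearson (P : Measure ℝ) (f : ℝ → ℝ) (μ δ β γ : ℝ) : Prop :=
  IsProbabilityMeasure P ∧
  (∀ x, 0 ≤ f x) ∧
  P = volume.withDensity (fun x => ENNReal.ofReal (f x)) ∧
  Integrable (fun x : ℝ => x) P ∧
  μ = ∫ x, x ∂P ∧
  0 < |δ| + |β| + |γ| ∧
  ∀ x : ℝ, (∫ t in Set.Iic x, (μ - t) * f t) = pq δ β γ x * f x

/-- Membership in the class `H^{m,n}(X)` for the distribution `P` of `X` with Pearson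
quadratic `q` and support `J`.  Here `gd k` plays the role of the `k`-th derivative
`g^{(k)}` of `g = gd 0` on `J`.  With `ℓ = max m n`:  `g ∈ C^{ℓ-1}(J)`
(encoded by `gd k` having derivative `gd (k+1)` at every point of `J` for `k+1 < ℓ`,
and `gd (ℓ-1)` continuous on `J`), `g^{(ℓ-1)}` is absolutely continuous on `J` with
a.e. derivative `g^{(ℓ)} = gd ℓ` (encoded by the fundamental theorem of calculus:
`gd ℓ` is locally integrable and `gd (ℓ-1)` is its integral on every subinterval of `J`),
and the moment conditions `E[q(X)^n (g^{(n)}(X))²] < ∞` and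
`E[q(X)^i |g^{(i)}(X)|] < ∞` for `n < i ≤ m` hold. -/
def MemH (P : Measure ℝ) (q : ℝ → ℝ) (J : Set ℝ) (m n : ℕ) (gd : ℕ → ℝ → ℝ) : Prop :=
  (∀ k, k + 1 < max m n → ∀ x ∈ J, HasDerivAt (gd k) (gd (k + 1) x) x) ∧
  (1 ≤ max m n → ContinuousOn (gd (max m n - 1)) J) ∧
  (1 ≤ max m n → ∀ a ∈ J, ∀ b ∈ J,
    IntervalIntegrable (gd (max m n)) volume a b ∧
      gd (max m n - 1) b - gd (max m n - 1) a = ∫ t in a..b, gd (max m n) t) ∧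
  Integrable (fun x => q x ^ n * (gd n x) ^ 2) P ∧
  ∀ i, n < i → i ≤ m → Integrable (fun x => q x ^ i * |gd i x|) P

/-- The variance bound `S_{m,n}(g)` of Theorem 2.1, for a Pearson distribution `P`
with quadratic `q` and parameter `δ`. -/
def Sbound (P : Measure ℝ) (δ : ℝ) (q : ℝ → ℝ) (m n : ℕ) (gd : ℕ → ℝ → ℝ) : ℝ :=
  (∑ i ∈ Finset.Icc 1 m,
      ((m.choose i : ℝ) * pp δ ((m : ℝ) + i) n /
          (fall ((m : ℝ) + n) i * (∫ x, q x ^ i ∂P) * pp δ ((i : ℝ) - 1) i *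
            pp δ (m : ℝ) n)) *
        (∫ x, q x ^ i * gd i x ∂P) ^ 2) +
    ∑ i ∈ Finset.Icc 1 n,
      (-1 : ℝ) ^ (i - 1) *
          ((n.choose i : ℝ) / (fall ((m : ℝ) + n) i * pp δ (m : ℝ) i)) *
        ∫ x, q x ^ i * (gd i x) ^ 2 ∂P

/-- `g(x) = x (1 - (x-1) δ)`. -/
def gq (δ x : ℝ) : ℝ := x * (1 - (x - 1) * δ)

/-- Newton basis element `u_i(x) = (x)_i ∏_{j=x-1}^{x+i-2} (1 - jδ)`. -/
def uu (δ x : ℝ) (i : ℕ) : ℝ := fall x i * pp δ (x - 1) i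

/-- Coefficients of the expansion. -/
def cc (δ : ℝ) (n m i : ℕ) : ℝ :=
  (-1 : ℝ) ^ i * (n.choose i : ℝ) / (fall ((m : ℝ) + n) i * pp δ (m : ℝ) i)

theorem uu_succ (δ x : ℝ) (i : ℕ) : uu δ x (i + 1) = uu δ x i * (gq δ x - gq δ i) := by
  unfold uu fall pp gq
  rw [Finset.prod_range_succ, Finset.prod_range_succ]
  ring

theorem uu_prod (δ x : ℝ) (i : ℕ) :
    uu δ x i = ∏ k ∈ Finset.range i, (gq δ x - gq δ k) := by
  induction i with
  | zero => simp [uu, fall, pp]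
  | succ k ih => rw [uu_succ, ih, Finset.prod_range_succ]

theorem fac_pos {δ : ℝ} (hδ : δ ≤ 0) {a : ℝ} (ha : 0 ≤ a) : 0 < 1 - a * δ := by
  nlinarith [mul_nonneg ha (neg_nonneg.2 hδ)]

theorem pp_pos {δ : ℝ} (hδ : δ ≤ 0) {a : ℝ} (ha : 0 ≤ a) (i : ℕ) : 0 < pp δ a i :=
  Finset.prod_pos fun j _ => fac_pos hδ (by positivity)

theorem fall_pos (N i : ℕ) (h : i ≤ N) : 0 < fall (N : ℝ) i := by
  refine Finset.prod_pos fun j hj => ?_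
  have h1 : j < N := lt_of_lt_of_le (Finset.mem_range.1 hj) h
  have : (j : ℝ) < N := by exact_mod_cast h1
  linarith

theorem gq_sub (δ x y : ℝ) : gq δ x - gq δ y = (x - y) * (1 - (x + y - 1) * δ) := by
  unfold gq; ring

theorem gq_lt {δ : ℝ} (hδ : δ ≤ 0) {a b : ℕ} (h : a < b) : gq δ a < gq δ b := by
  have h1 : (a : ℝ) + 1 ≤ b := by exact_mod_cast h
  have h0 : (0 : ℝ) ≤ a := by positivity
  have := gq_sub δ b a
  have h2 : 0 < ((b : ℝ) - a) * (1 - ((b : ℝ) + a - 1) * δ) :=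
    mul_pos (by linarith) (fac_pos hδ (by linarith))
  linarith

theorem cc_rec {δ : ℝ} (hδ : δ ≤ 0) (n m k : ℕ) (hk : k ≤ n) :
    cc δ (n + 1) m (k + 1) =
      cc δ n (m + 1) (k + 1) * (1 - gq δ ((k + 1 : ℕ) : ℝ) / gq δ ((m + 1 : ℕ) : ℝ)) -
        cc δ n (m + 1) k / gq δ ((m + 1 : ℕ) : ℝ) := by
  unfold cc
  have e1 : ((m + 1 : ℕ) : ℝ) + n = ((m + n + 1 : ℕ) : ℝ) := by push_cast; ring
  have e2 : (m : ℝ) + ((n + 1 : ℕ) : ℝ) = ((m + n + 1 : ℕ) : ℝ) := by push_cast; ring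
  rw [e1, e2]
  have f1 : fall ((m + n + 1 : ℕ) : ℝ) (k + 1)
      = fall ((m + n + 1 : ℕ) : ℝ) k * ((m : ℝ) + n + 1 - k) := by
    unfold fall; rw [Finset.prod_range_succ]; push_cast; ring
  have p1 : pp δ (m : ℝ) (k + 1) = (1 - m * δ) * pp δ ((m + 1 : ℕ) : ℝ) k := by
    unfold pp; rw [Finset.prod_range_succ', mul_comm]
    congr 1
    · simp
    · refine Finset.prod_congr rfl fun j _ => ?_
      push_cast; ring
  have p2 : pp δ ((m + 1 : ℕ) : ℝ) (k + 1)
      = pp δ ((m + 1 : ℕ) : ℝ) k * (1 - ((m : ℝ) + 1 + k) * δ) := by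
    unfold pp; rw [Finset.prod_range_succ]; push_cast; ring
  have hF := (fall_pos (m + n + 1) k (by omega)).ne'
  have hP := (pp_pos hδ (a := ((m + 1 : ℕ) : ℝ)) (by positivity) k).ne'
  have hkn : (k : ℝ) ≤ n := by exact_mod_cast hk
  have hm0 : (0 : ℝ) ≤ m := by positivity
  have hN : (m : ℝ) + n + 1 - k ≠ 0 := by linarith
  have hm : 1 - (m : ℝ) * δ ≠ 0 := (fac_pos hδ (by positivity)).ne'
  have hmk : 1 - ((m : ℝ) + 1 + k) * δ ≠ 0 := (fac_pos hδ (by positivity)).ne'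
  have hm1 : (m : ℝ) + 1 ≠ 0 := by positivity
  have hg : gq δ ((m + 1 : ℕ) : ℝ) = ((m : ℝ) + 1) * (1 - m * δ) := by
    unfold gq; push_cast; ring
  have hd : 1 - gq δ ((k + 1 : ℕ) : ℝ) / gq δ ((m + 1 : ℕ) : ℝ)
      = ((m : ℝ) - k) * (1 - ((m : ℝ) + 1 + k) * δ) / (((m : ℝ) + 1) * (1 - m * δ)) := by
    rw [hg, eq_div_iff (mul_ne_zero hm1 hm), sub_mul,
      div_mul_cancel₀ _ (mul_ne_zero hm1 hm)]
    unfold gq; push_cast; ring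
  rw [hd, hg, f1, p1, p2]
  have hc : ((n + 1).choose (k + 1) : ℝ) = n.choose k + n.choose (k + 1) := by
    rw [Nat.choose_succ_succ]; push_cast; ring
  have hc2 : (n.choose (k + 1) : ℝ) * (k + 1) = n.choose k * (n - k) := by
    have := Nat.choose_succ_right_eq n k
    have h3 : ((n - k : ℕ) : ℝ) = n - k := Nat.cast_sub hk
    rw [← h3]; exact_mod_cast this
  rw [hc]
  generalize fall ((m + n + 1 : ℕ) : ℝ) k = F at *
  generalize pp δ ((m + 1 : ℕ) : ℝ) k = P at *
  have L : (-1 : ℝ) ^ (k + 1) * (n.choose k + n.choose (k + 1)) /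
      (F * ((m : ℝ) + n + 1 - k) * ((1 - m * δ) * P)) =
      (-1 : ℝ) ^ (k + 1) * (((m : ℝ) + 1) * (n.choose k + n.choose (k + 1))) /
      (F * ((m : ℝ) + n + 1 - k) * ((1 - m * δ) * P) * (m + 1)) := by
    field_simp
  have R1 : (-1 : ℝ) ^ (k + 1) * (n.choose (k + 1)) /
      (F * ((m : ℝ) + n + 1 - k) * (P * (1 - ((m : ℝ) + 1 + k) * δ))) *
      (((m : ℝ) - k) * (1 - ((m : ℝ) + 1 + k) * δ) / (((m : ℝ) + 1) * (1 - m * δ))) =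
      (-1 : ℝ) ^ (k + 1) * (((m : ℝ) - k) * n.choose (k + 1)) /
      (F * ((m : ℝ) + n + 1 - k) * ((1 - m * δ) * P) * (m + 1)) := by
    rw [div_mul_div_comm, div_eq_div_iff (by positivity) (by positivity)]
    ring
  have R2 : (-1 : ℝ) ^ k * (n.choose k) / (F * P) / (((m : ℝ) + 1) * (1 - m * δ)) =
      - ((-1 : ℝ) ^ (k + 1) * (((m : ℝ) + n + 1 - k) * n.choose k)) /
      (F * ((m : ℝ) + n + 1 - k) * ((1 - m * δ) * P) * (m + 1)) := by
    rw [div_div, div_eq_div_iff (by positivity) (by positivity)]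
    ring
  rw [L, R1, R2, ← sub_div]
  congr 1
  linear_combination (-1 : ℝ) ^ (k + 1) * hc2

theorem sum_rec {δ : ℝ} (hδ : δ ≤ 0) (n m : ℕ) (x : ℝ) (k : ℕ) (hk : k ≤ n + 1) :
    ∑ i ∈ Finset.range (k + 1), cc δ (n + 1) m i * uu δ x i =
      (∑ i ∈ Finset.range (k + 1), cc δ n (m + 1) i * uu δ x i) *
          (1 - gq δ x / gq δ ((m + 1 : ℕ) : ℝ)) +
        cc δ n (m + 1) k * uu δ x (k + 1) / gq δ ((m + 1 : ℕ) : ℝ) := by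
  induction k with
  | zero => simp [cc, uu_succ, fall, pp, uu, gq]
  | succ k ih =>
    rw [Finset.sum_range_succ, ih (by omega), Finset.sum_range_succ _ (k + 1),
      cc_rec hδ n m k (by omega), uu_succ δ x (k + 1)]
    ring

theorem sum_zero {δ : ℝ} (hδ : δ ≤ 0) (n : ℕ) : ∀ (m r : ℕ), r < n →
    ∑ i ∈ Finset.range (n + 1), cc δ n m i * uu δ ((m + r + 1 : ℕ) : ℝ) i = 0 := by
  induction n with
  | zero => intro m r h; omega
  | succ n ih =>
    intro m r h
    have h0 : cc δ n (m + 1) (n + 1) = 0 := by simp [cc]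
    rw [sum_rec hδ n m _ (n + 1) le_rfl, Finset.sum_range_succ, h0]
    rcases r with _ | r
    · have : gq δ ((m + 1 : ℕ) : ℝ) ≠ 0 := by
        have := gq_lt hδ (Nat.succ_pos m)
        simp only [gq, Nat.cast_zero, zero_mul] at this ⊢
        exact this.ne'
      simp only [Nat.add_zero]
      rw [div_self this]; ring
    · have := ih (m + 1) r (by omega)
      rw [show m + (r + 1) + 1 = m + 1 + r + 1 by ring, this]; ring

theorem det_ne {δ : ℝ} (hδ : δ ≤ 0) (n m : ℕ) :
    (Matrix.of fun r c : Fin n => uu δ ((m + r + 1 : ℕ) : ℝ) ((c : ℕ) + 1)).det ≠ 0 := by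
  let p : Fin n → Polynomial ℝ := fun c =>
    ∏ k ∈ Finset.range (c : ℕ), (Polynomial.X - Polynomial.C (gq δ ((k + 1 : ℕ) : ℝ)))
  let y : Fin n → ℝ := fun r => gq δ ((m + r + 1 : ℕ) : ℝ)
  have hA : (Matrix.of fun r c : Fin n => uu δ ((m + r + 1 : ℕ) : ℝ) ((c : ℕ) + 1)) =
      Matrix.of fun r c => y r * (Matrix.of fun i j => (p j).eval (y i)) r c := by
    ext r c
    simp only [Matrix.of_apply, p, y]
    rw [uu_prod, Finset.prod_range_succ', Polynomial.eval_prod, mul_comm]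
    simp [gq]
  have hv := Matrix.det_eval_matrixOfPolynomials_eq_det_vandermonde y p
    (fun i => by simp [p, Polynomial.natDegree_prod_of_monic, Polynomial.monic_X_sub_C])
    (fun i => Polynomial.monic_prod_of_monic _ _ fun k _ => Polynomial.monic_X_sub_C _)
  rw [hA, Matrix.det_mul_column, ← hv]
  refine mul_ne_zero (Finset.prod_ne_zero_iff.2 fun r _ => ?_)
    (Matrix.det_vandermonde_ne_zero_iff.2 ?_)
  · have := gq_lt hδ (Nat.succ_pos (m + r))
    have h0 : gq δ ((0 : ℕ) : ℝ) = 0 := by simp [gq]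
    rw [h0] at this
    exact this.ne'
  · have : StrictMono y := fun a b hab => gq_lt hδ (by have : (a : ℕ) < b := hab; omega)
    exact this.injective

/-- **The linear system (2.6) and its solution (2.7).** For `n ≥ 1` and `δ ≤ 0`,
the `n × n` system `A_{m,n} λ = (1,…,1)ᵗ`, where the `(r,c)`-entry of `A_{m,n}`
(for `1 ≤ r, c ≤ n`) is `(m+r)_c ∏_{j=m+r−1}^{m+r+c−2}(1−jδ)`, has the unique
solution `λ_i = (−1)^{i−1} C(n,i) / ((m+n)_i ∏_{j=m}^{m+i−1}(1−jδ))`. -/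
theorem pearson_system_solution (m n : ℕ) (hn : 1 ≤ n) (δ : ℝ) (hδ : δ ≤ 0) :
    let A : Matrix (Fin n) (Fin n) ℝ := fun r c =>
      fall ((m : ℝ) + (r : ℕ) + 1) ((c : ℕ) + 1) * pp δ ((m : ℝ) + (r : ℕ)) ((c : ℕ) + 1)
    let lam : Fin n → ℝ := fun i =>
      (-1 : ℝ) ^ (i : ℕ) * (n.choose ((i : ℕ) + 1) : ℝ) /
        (fall ((m : ℝ) + n) ((i : ℕ) + 1) * pp δ (m : ℝ) ((i : ℕ) + 1))
    A.mulVec lam = (fun _ => 1) ∧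
      ∀ v : Fin n → ℝ, A.mulVec v = (fun _ => 1) → v = lam := by
  intro A lam
  have hA : A = Matrix.of fun r c : Fin n => uu δ ((m + r + 1 : ℕ) : ℝ) ((c : ℕ) + 1) := by
    ext r c
    simp only [A, Matrix.of_apply, uu]
    push_cast
    congr 2
    ring
  have hl : ∀ i : Fin n, lam i = - cc δ n m ((i : ℕ) + 1) := by
    intro i
    simp only [lam, cc]
    ring
  have hsol : A.mulVec lam = fun _ => 1 := by
    funext r
    have h := sum_zero hδ n m r r.2
    rw [Finset.sum_range_succ', ← Fin.sum_univ_eq_sum_range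
      (fun i => cc δ n m (i + 1) * uu δ ((m + r + 1 : ℕ) : ℝ) (i + 1))] at h
    have h0 : cc δ n m 0 * uu δ ((m + r + 1 : ℕ) : ℝ) 0 = 1 := by
      simp [cc, uu, fall, pp]
    rw [h0] at h
    have h2 : A.mulVec lam r = - ∑ i : Fin n,
        cc δ n m ((i : ℕ) + 1) * uu δ ((m + r + 1 : ℕ) : ℝ) ((i : ℕ) + 1) := by
      rw [hA, ← Finset.sum_neg_distrib]
      simp only [Matrix.mulVec, dotProduct, Matrix.of_apply, hl]
      refine Finset.sum_congr rfl fun i _ => ?_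
      ring
    rw [h2]; linarith
  refine ⟨hsol, fun v hv => ?_⟩
  have hdet : A.det ≠ 0 := by rw [hA]; exact det_ne hδ n m
  have hz : A.mulVec (v - lam) = 0 := by rw [Matrix.mulVec_sub, hv, hsol, sub_self]
  exact sub_eq_zero.1 (Matrix.eq_zero_of_mulVec_eq_zero hdet hz)

end
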